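/- Fix q ∈ ℝ with 0 < q < 1/2 and let a(Δ) := (Q(q)^Δ)_{1,0}. For integers H ≥ 1 define N(H) := a(H) − H·(a(H) − a(H−1)) and Den(H) := (H−1)(a(H−1) − a(H)) + a(H) + q. Then Den(H) = N(H) + q(1 + (1−2q)^{H−1}) > 0 for every H ≥ 1, and consequently the Whittle index W(H) := N(H)/Den(H) is well defined and satisfies 0 ≤ W(H) < 1 for all H ≥ 1, with W(1) = 0. -/

import Mathlib

open Matrix

/-- The one-step transition matrix of a symmetric two-state Markov chain
with switching probability `q`. -/
def Qmat (q : ℝ) : Matrix (Fin 2) (Fin 2) ℝ := !![1 - q, q; q, 1 - q]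

/-- `a q Δ` is the `(1,0)` entry of the `Δ`-th power of `Qmat q`. -/
def a (q : ℝ) (Δ : ℕ) : ℝ := (Qmat q ^ Δ) 1 0

/-- Numerator of the Whittle index in state `(X̂ = 1, AoI = H)`. -/
def Nnum (q : ℝ) (H : ℕ) : ℝ := a q H - H * (a q H - a q (H - 1))

/-- Denominator of the Whittle index in state `(X̂ = 1, AoI = H)`. -/
def Den (q : ℝ) (H : ℕ) : ℝ := ((H : ℝ) - 1) * (a q (H - 1) - a q H) + a q H + q

/-- The Whittle index in state `(X̂ = 1, AoI = H)`. -/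
noncomputable def W (q : ℝ) (H : ℕ) : ℝ := Nnum q H / Den q H

theorem Qmat_pow (q : ℝ) (n : ℕ) :
    Qmat q ^ n = !![(1 + (1 - 2*q)^n) / 2, (1 - (1 - 2*q)^n) / 2;
      (1 - (1 - 2*q)^n) / 2, (1 + (1 - 2*q)^n) / 2] := by
  induction n with
  | zero => ext i j; fin_cases i <;> fin_cases j <;> norm_num
  | succ n ih =>
    rw [pow_succ, ih, Qmat]
    ext i j
    fin_cases i <;> fin_cases j <;> simp [Matrix.mul_apply, Fin.sum_univ_two] <;> ring

theorem a_eq (q : ℝ) (n : ℕ) : a q n = (1 - (1 - 2*q)^n) / 2 := by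
  simp [a, Qmat_pow]

theorem Nnum_one (q : ℝ) : Nnum q 1 = 0 := by
  simp [Nnum, a_eq]

theorem Nnum_succ_succ (q : ℝ) (n : ℕ) :
    Nnum q (n + 2) = Nnum q (n + 1) + (n + 1) * (2 * q^2 * (1 - 2*q)^n) := by
  simp only [Nnum, a_eq, Nat.add_one_sub_one, show n + 2 - 1 = n + 1 from rfl]
  push_cast
  ring

theorem Nnum_succ_nonneg {q : ℝ} (hq : q ≤ 1/2) (n : ℕ) : 0 ≤ Nnum q (n + 1) := by
  induction n with
  | zero => simp [Nnum_one]
  | succ n ih =>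
    have : 0 ≤ 1 - 2*q := by linarith
    rw [Nnum_succ_succ]
    positivity

theorem Den_succ (q : ℝ) (n : ℕ) :
    Den q (n + 1) = Nnum q (n + 1) + q * (1 + (1 - 2*q)^n) := by
  simp only [Den, Nnum, a_eq, Nat.add_one_sub_one]
  ring

theorem stmt_10 (q : ℝ) (hq0 : 0 < q) (hq1 : q < 1/2) :
    (∀ H : ℕ, 1 ≤ H →
      Den q H = Nnum q H + q * (1 + (1 - 2*q)^(H - 1)) ∧ 0 < Den q H) ∧
    (∀ H : ℕ, 1 ≤ H → 0 ≤ W q H ∧ W q H < 1) ∧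
    W q 1 = 0 := by
  have gap_pos (n : ℕ) : 0 < q * (1 + (1 - 2*q)^n) := by
    have : 0 < 1 - 2*q := by linarith
    positivity
  have den_pos (n : ℕ) : 0 < Den q (n + 1) := by
    rw [Den_succ]
    exact add_pos_of_nonneg_of_pos (Nnum_succ_nonneg hq1.le n) (gap_pos n)
  refine ⟨fun H hH => ?_, fun H hH => ?_, by simp [W, Nnum_one]⟩
  · obtain ⟨n, rfl⟩ := Nat.exists_eq_add_of_le' hH
    exact ⟨Den_succ q n, den_pos n⟩
  · obtain ⟨n, rfl⟩ := Nat.exists_eq_add_of_le' hH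
    refine ⟨div_nonneg (Nnum_succ_nonneg hq1.le n) (den_pos n).le, ?_⟩
    rw [W, div_lt_one (den_pos n), Den_succ]
    exact lt_add_of_pos_right _ (gap_pos n)
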